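/- Rescaled interior derivative estimate: there is a constant a_m ≥ 1, depending only on the dimension, such that for any solution u of the heat equation on an open set Ω, any 0 < r < 1, and any point a with the closed ball of radius r around a contained in Ω, one has sup_{B_{r²/4}(a)} |∂^k u| ≤ (a_m / r^{2|k|}) · sup_{B_r(a)} |u| for all multiindices k with |k| ∈ {1, 2}. -/

import Mathlib

open scoped BigOperators
open Metric

/-- Partial derivative of `f` in the `i`-th coordinate direction. -/
noncomputable def pd {n : ℕ} {F : Type*} [NormedAddCommGroup F] [NormedSpace ℝ F]
    (i : Fin n) (f : EuclideanSpace ℝ (Fin n) → F) : EuclideanSpace ℝ (Fin n) → F :=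
  fun z => fderiv ℝ f z (EuclideanSpace.single i 1)

/-- Iterated partial derivative in the `i`-th coordinate direction. -/
noncomputable def pdIter {n : ℕ} {F : Type*} [NormedAddCommGroup F] [NormedSpace ℝ F]
    (i : Fin n) : ℕ → (EuclideanSpace ℝ (Fin n) → F) → EuclideanSpace ℝ (Fin n) → F
  | 0, f => f
  | k + 1, f => pd i (pdIter i k f)

/-- The mixed partial derivative `∂^k f` associated to the multiindex `k`. -/
noncomputable def mderiv {n : ℕ} {F : Type*} [NormedAddCommGroup F] [NormedSpace ℝ F]
    (k : Fin n → ℕ) (f : EuclideanSpace ℝ (Fin n) → F) : EuclideanSpace ℝ (Fin n) → F :=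
  (List.finRange n).foldr (fun i g => pdIter i (k i) g) f

/-- `u` solves the heat equation `Δu - ∂ₜu = 0` on `Ω ⊆ ℝ^{m+1}`, where the first `m`
coordinates are spatial and the last coordinate is time. -/
def IsHeatSolution {m : ℕ} (Ω : Set (EuclideanSpace ℝ (Fin (m + 1))))
    (u : EuclideanSpace ℝ (Fin (m + 1)) → ℝ) : Prop :=
  ∀ z ∈ Ω, (∑ i : Fin m, pd i.castSucc (pd i.castSucc u) z) - pd (Fin.last m) u z = 0

/-- The parabolic rescaling `(x, t) ↦ (rx, r²t)` of `ℝ^{m+1}`. -/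
noncomputable def parabolicScale (m : ℕ) (r : ℝ) :
    EuclideanSpace ℝ (Fin (m + 1)) → EuclideanSpace ℝ (Fin (m + 1)) :=
  fun z => (WithLp.equiv 2 (Fin (m + 1) → ℝ)).symm
    (fun i => if i = Fin.last m then r ^ 2 * z i else r * z i)

open scoped ContDiff Topology

section PartialDerivatives

variable {n : ℕ} {f g : EuclideanSpace ℝ (Fin n) → ℝ}

lemma ContDiff.pd (i : Fin n) (hf : ContDiff ℝ ∞ f) : ContDiff ℝ ∞ (pd i f) :=
  (hf.fderiv_right (m := ∞) (by simp)).clm_apply contDiff_const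

lemma ContDiff.differentiable_of_infty (hf : ContDiff ℝ ∞ f) : Differentiable ℝ f :=
  hf.differentiable (by simp)

lemma pd_add (i : Fin n) (hf : ContDiff ℝ ∞ f) (hg : ContDiff ℝ ∞ g) :
    pd i (fun z => f z + g z) = fun z => pd i f z + pd i g z := by
  funext z
  simp [pd, fderiv_fun_add (hf.differentiable_of_infty z) (hg.differentiable_of_infty z)]

lemma pd_mul (i : Fin n) (hf : ContDiff ℝ ∞ f) (hg : ContDiff ℝ ∞ g) :
    pd i (fun z => f z * g z) = fun z => f z * pd i g z + g z * pd i f z := by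
  funext z
  simp [pd, fderiv_fun_mul (hf.differentiable_of_infty z) (hg.differentiable_of_infty z)]

lemma pd_const (i : Fin n) (c : ℝ) :
    pd i (fun _ : EuclideanSpace ℝ (Fin n) => c) = fun _ => 0 := by
  funext z
  simp [pd]

lemma pd_sum {ι : Type*} (s : Finset ι) (i : Fin n) {f : ι → EuclideanSpace ℝ (Fin n) → ℝ}
    (hf : ∀ j, ContDiff ℝ ∞ (f j)) :
    pd i (fun z => ∑ j ∈ s, f j z) = fun z => ∑ j ∈ s, pd i (f j) z := by
  funext z
  simp [pd, fderiv_fun_sum fun j _ => (hf j).differentiable_of_infty z]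

lemma pd_coord (i j : Fin n) :
    pd i (fun z : EuclideanSpace ℝ (Fin n) => z j) = fun _ => if j = i then 1 else 0 := by
  funext z
  have h : HasFDerivAt (fun z : EuclideanSpace ℝ (Fin n) => z j)
      (EuclideanSpace.proj j : EuclideanSpace ℝ (Fin n) →L[ℝ] ℝ) z :=
    (EuclideanSpace.proj j : EuclideanSpace ℝ (Fin n) →L[ℝ] ℝ).hasFDerivAt
  simp [pd, h.fderiv]

lemma contDiff_coord (j : Fin n) :
    ContDiff ℝ ∞ (fun z : EuclideanSpace ℝ (Fin n) => z j) :=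
  (EuclideanSpace.proj j : EuclideanSpace ℝ (Fin n) →L[ℝ] ℝ).contDiff

lemma pd_comm (i j : Fin n) (hf : ContDiff ℝ ∞ f) : pd i (pd j f) = pd j (pd i f) := by
  have key : ∀ (i j : Fin n) (z : EuclideanSpace ℝ (Fin n)), pd i (pd j f) z =
      fderiv ℝ (fderiv ℝ f) z (EuclideanSpace.single i 1) (EuclideanSpace.single j 1) := by
    intro i j z
    have hd : DifferentiableAt ℝ (fderiv ℝ f) z :=
      (hf.fderiv_right (m := ∞) (by simp)).differentiable (by simp) z
    change fderiv ℝ (fun y => fderiv ℝ f y (EuclideanSpace.single j 1)) z _ = _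
    simp [fderiv_clm_apply hd (differentiableAt_const _)]
  funext z
  rw [key, key]
  exact (hf.contDiffAt.isSymmSndFDerivAt (by
    simpa using ENat.LEInfty.out)).eq _ _

lemma pd_congr {z : EuclideanSpace ℝ (Fin n)} (i : Fin n) (h : f =ᶠ[𝓝 z] g) :
    pd i f =ᶠ[𝓝 z] pd i g :=
  h.fderiv.fun_comp fun L => L (EuclideanSpace.single i 1)

lemma hasDerivAt_slice (i : Fin n) (hf : ContDiff ℝ ∞ f) (z : EuclideanSpace ℝ (Fin n))
    (s : ℝ) : HasDerivAt (fun s : ℝ => f (z + s • EuclideanSpace.single i 1))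
      (pd i f (z + s • EuclideanSpace.single i 1)) s := by
  have h : HasDerivAt (fun s : ℝ => z + s • EuclideanSpace.single i (1 : ℝ))
      (EuclideanSpace.single i (1 : ℝ)) s := by
    simpa using ((hasDerivAt_id s).smul_const (EuclideanSpace.single i (1 : ℝ))).const_add z
  exact (hf.differentiable_of_infty _).hasFDerivAt.comp_hasDerivAt s h

/-- The second derivative of a function is nonpositive at a local maximum. -/
lemma IsLocalMax.deriv_deriv_nonpos {g : ℝ → ℝ} {x : ℝ} (hx : IsLocalMax g x)
    (hg : ContinuousAt g x) : deriv (deriv g) x ≤ 0 := by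
  by_contra! hpos
  have hmin := isLocalMin_of_deriv_deriv_pos hpos hx.deriv_eq_zero hg
  have hc : g =ᶠ[𝓝 x] fun _ => g x := by
    filter_upwards [hx, hmin] with y h₁ h₂ using le_antisymm h₁ h₂
  have h0 : deriv (deriv g) x = 0 := by
    rw [hc.deriv.deriv_eq]
    simp
  exact hpos.ne' h0

lemma pd_pd_nonpos_of_slice_max (i : Fin n) (hf : ContDiff ℝ ∞ f)
    {z : EuclideanSpace ℝ (Fin n)}
    (hz : ∀ᶠ s : ℝ in 𝓝 0, f (z + s • EuclideanSpace.single i 1) ≤ f z) :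
    pd i (pd i f) z ≤ 0 := by
  have hmax : IsLocalMax (fun s : ℝ => f (z + s • EuclideanSpace.single i 1)) 0 := by
    filter_upwards [hz] with s hs
    simpa using hs
  have h := hmax.deriv_deriv_nonpos (hasDerivAt_slice i hf z 0).continuousAt
  have h₁ : deriv (fun s : ℝ => f (z + s • EuclideanSpace.single i 1)) =
      fun s => pd i f (z + s • EuclideanSpace.single i 1) :=
    funext fun s => (hasDerivAt_slice i hf z s).deriv
  rw [h₁, (hasDerivAt_slice i (hf.pd i) z 0).deriv] at h
  simpa using h

lemma pd_nonneg_of_backward_slice_max (i : Fin n) (hf : ContDiff ℝ ∞ f)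
    {z : EuclideanSpace ℝ (Fin n)}
    (hz : ∀ᶠ s : ℝ in 𝓝[<] 0, f (z + s • EuclideanSpace.single i 1) ≤ f z) :
    0 ≤ pd i f z := by
  have h := (hasDerivAt_slice i hf z 0).hasDerivWithinAt (s := Set.Iio 0)
  rw [hasDerivWithinAt_iff_tendsto_slope' (by simp)] at h
  have h0 := ge_of_tendsto h (b := 0) (by
    filter_upwards [hz, self_mem_nhdsWithin] with s hs hs0
    rw [slope_def_field]
    exact div_nonneg_of_nonpos (by simpa using hs) (by simpa using le_of_lt hs0))
  simpa using h0

end PartialDerivatives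

section HeatOperator

variable {m : ℕ} {f g : EuclideanSpace ℝ (Fin (m + 1)) → ℝ}

/-- The heat operator `Δ - ∂ₜ`, the last coordinate being time. -/
noncomputable def heatOp (f : EuclideanSpace ℝ (Fin (m + 1)) → ℝ) :
    EuclideanSpace ℝ (Fin (m + 1)) → ℝ :=
  fun z => (∑ i : Fin m, pd i.castSucc (pd i.castSucc f) z) - pd (Fin.last m) f z

lemma heatOp_add (hf : ContDiff ℝ ∞ f) (hg : ContDiff ℝ ∞ g)
    (z : EuclideanSpace ℝ (Fin (m + 1))) :
    heatOp (fun z => f z + g z) z = heatOp f z + heatOp g z := by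
  simp only [heatOp, pd_add _ hf hg, pd_add _ (hf.pd _) (hg.pd _), Finset.sum_add_distrib]
  ring

lemma heatOp_mul (hf : ContDiff ℝ ∞ f) (hg : ContDiff ℝ ∞ g)
    (z : EuclideanSpace ℝ (Fin (m + 1))) :
    heatOp (fun z => f z * g z) z = f z * heatOp g z + g z * heatOp f z +
      2 * ∑ i : Fin m, pd i.castSucc f z * pd i.castSucc g z := by
  simp only [heatOp, pd_mul _ hf hg, pd_add _ (hf.mul (hg.pd _)) (hg.mul (hf.pd _)),
    pd_mul _ hf (hg.pd _), pd_mul _ hg (hf.pd _), Finset.sum_add_distrib, mul_sub,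
    Finset.mul_sum, two_mul]
  have h : ∑ i : Fin m, pd i.castSucc g z * pd i.castSucc f z =
      ∑ i : Fin m, pd i.castSucc f z * pd i.castSucc g z :=
    Finset.sum_congr rfl fun i _ => mul_comm _ _
  rw [h]
  ring

lemma heatOp_const (c : ℝ) (z : EuclideanSpace ℝ (Fin (m + 1))) :
    heatOp (fun _ => c) z = 0 := by
  simp [heatOp, pd_const]

lemma heatOp_const_mul (c : ℝ) (hf : ContDiff ℝ ∞ f) (z : EuclideanSpace ℝ (Fin (m + 1))) :
    heatOp (fun z => c * f z) z = c * heatOp f z := by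
  simp [heatOp_mul contDiff_const hf, heatOp_const, pd_const]

lemma IsHeatSolution.pd {U : Set (EuclideanSpace ℝ (Fin (m + 1)))} (hU : IsOpen U)
    (hf : ContDiff ℝ ∞ f) (hheat : IsHeatSolution U f) (j : Fin (m + 1)) :
    IsHeatSolution U (pd j f) := by
  intro z hz
  have hcomm : heatOp (_root_.pd j f) z = _root_.pd j (heatOp f) z := by
    have h1 : heatOp f = fun z => (∑ i : Fin m, _root_.pd i.castSucc (_root_.pd i.castSucc f) z)
        + (-1) * _root_.pd (Fin.last m) f z := by
      funext z
      simp [heatOp, sub_eq_add_neg]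
    rw [h1, pd_add _ (ContDiff.sum fun i _ => (hf.pd _).pd _)
      (contDiff_const.mul (hf.pd _)), pd_sum _ _ fun i => (hf.pd _).pd _,
      pd_mul _ contDiff_const (hf.pd _), pd_const]
    simp only [heatOp, pd_comm j _ (hf.pd _), pd_comm j _ hf]
    ring
  have h0 : heatOp f =ᶠ[𝓝 z] fun _ => 0 := by
    filter_upwards [hU.mem_nhds hz] with y hy using hheat y hy
  have := (pd_congr j h0).eq_of_nhds
  rw [pd_const] at this
  exact hcomm.trans this

end HeatOperator

section Bernstein

variable {m : ℕ}

/-- The squared distance between the spatial parts of `z` and `c`. -/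
noncomputable def spatialSqDist (c z : EuclideanSpace ℝ (Fin (m + 1))) : ℝ :=
  ∑ i : Fin m, (z i.castSucc - c i.castSucc) * (z i.castSucc - c i.castSucc)

/-- The closed backward parabolic cylinder of radius `ρ` with top centre `c`. -/
def parabolicCylinder (c : EuclideanSpace ℝ (Fin (m + 1))) (ρ : ℝ) :
    Set (EuclideanSpace ℝ (Fin (m + 1))) :=
  {z | spatialSqDist c z ≤ ρ ^ 2 ∧
    c (Fin.last m) - ρ ^ 2 ≤ z (Fin.last m) ∧ z (Fin.last m) ≤ c (Fin.last m)}

lemma spatialSqDist_nonneg (c z : EuclideanSpace ℝ (Fin (m + 1))) : 0 ≤ spatialSqDist c z :=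
  Finset.sum_nonneg fun _ _ => mul_self_nonneg _

lemma spatialSqDist_self (c : EuclideanSpace ℝ (Fin (m + 1))) : spatialSqDist c c = 0 := by
  simp [spatialSqDist]

lemma dist_sq_eq_spatialSqDist_add (c z : EuclideanSpace ℝ (Fin (m + 1))) :
    dist z c ^ 2 = spatialSqDist c z + (z (Fin.last m) - c (Fin.last m)) ^ 2 := by
  rw [EuclideanSpace.dist_eq, Real.sq_sqrt (Finset.sum_nonneg fun _ _ => sq_nonneg _),
    Fin.sum_univ_castSucc]
  simp [spatialSqDist, Real.dist_eq, sq]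

lemma contDiff_sub_coord (c : EuclideanSpace ℝ (Fin (m + 1))) (j : Fin (m + 1)) :
    ContDiff ℝ ∞ (fun z : EuclideanSpace ℝ (Fin (m + 1)) => z j - c j) :=
  (contDiff_coord j).sub contDiff_const

lemma contDiff_spatialSqDist (c : EuclideanSpace ℝ (Fin (m + 1))) :
    ContDiff ℝ ∞ (spatialSqDist c) :=
  ContDiff.sum fun i _ => (contDiff_sub_coord c i.castSucc).mul (contDiff_sub_coord c i.castSucc)

lemma pd_sub_coord (c : EuclideanSpace ℝ (Fin (m + 1))) (i j : Fin (m + 1)) :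
    pd i (fun z : EuclideanSpace ℝ (Fin (m + 1)) => z j - c j) =
      fun _ => if j = i then 1 else 0 := by
  simp only [sub_eq_add_neg]
  rw [pd_add i (contDiff_coord j) contDiff_const, pd_coord, pd_const]
  simp

lemma pd_spatialSqDist_castSucc (c : EuclideanSpace ℝ (Fin (m + 1))) (i : Fin m) :
    pd i.castSucc (spatialSqDist c) = fun z => 2 * (z i.castSucc - c i.castSucc) := by
  unfold spatialSqDist
  rw [pd_sum _ _ fun j : Fin m =>
    (contDiff_sub_coord c j.castSucc).mul (contDiff_sub_coord c j.castSucc)]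
  funext z
  simp [pd_mul _ (contDiff_sub_coord c _) (contDiff_sub_coord c _), pd_sub_coord,
    Finset.sum_add_distrib, two_mul]

lemma pd_spatialSqDist_last (c : EuclideanSpace ℝ (Fin (m + 1))) :
    pd (Fin.last m) (spatialSqDist c) = fun _ => 0 := by
  unfold spatialSqDist
  rw [pd_sum _ _ fun j : Fin m =>
    (contDiff_sub_coord c j.castSucc).mul (contDiff_sub_coord c j.castSucc)]
  funext z
  simp [pd_mul _ (contDiff_sub_coord c _) (contDiff_sub_coord c _), pd_sub_coord]

lemma heatOp_spatialSqDist (c z : EuclideanSpace ℝ (Fin (m + 1))) :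
    heatOp (spatialSqDist c) z = 2 * m := by
  simp only [heatOp, pd_spatialSqDist_castSucc, pd_spatialSqDist_last]
  simp [pd_mul _ contDiff_const (contDiff_sub_coord c _), pd_sub_coord, pd_const, mul_comm]

lemma mem_parabolicCylinder_self (c : EuclideanSpace ℝ (Fin (m + 1))) (ρ : ℝ) :
    c ∈ parabolicCylinder c ρ := by
  refine ⟨?_, ?_, le_rfl⟩
  · rw [spatialSqDist_self]
    positivity
  · linarith [sq_nonneg ρ]

lemma isCompact_parabolicCylinder (c : EuclideanSpace ℝ (Fin (m + 1))) (ρ : ℝ) :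
    IsCompact (parabolicCylinder c ρ) := by
  refine Metric.isCompact_of_isClosed_isBounded ?_ ?_
  · have hl : Continuous fun z : EuclideanSpace ℝ (Fin (m + 1)) => z (Fin.last m) :=
      (contDiff_coord _).continuous
    exact (isClosed_le (contDiff_spatialSqDist c).continuous continuous_const).inter
      ((isClosed_le continuous_const hl).inter (isClosed_le hl continuous_const))
  · refine Metric.isBounded_closedBall (x := c) (r := ρ ^ 2 + 1) |>.subset fun z hz => ?_
    obtain ⟨h₁, h₂, h₃⟩ := hz
    rw [mem_closedBall]
    refine abs_le_of_sq_le_sq' ?_ (by positivity) |>.2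
    rw [dist_sq_eq_spatialSqDist_add]
    nlinarith [sq_nonneg ρ]

lemma parabolicCylinder_subset {c z : EuclideanSpace ℝ (Fin (m + 1))} {ρ σ : ℝ} (hρ : 0 ≤ ρ)
    (hσ : 0 ≤ σ) (hz : z ∈ parabolicCylinder c ρ) :
    parabolicCylinder z σ ⊆ parabolicCylinder c (ρ + σ) := by
  rintro y ⟨h₁, h₂, h₃⟩
  obtain ⟨h₁', h₂', h₃'⟩ := hz
  refine ⟨?_, by nlinarith [mul_nonneg hρ hσ], by linarith⟩
  have hcs := Finset.sum_mul_sq_le_sq_mul_sq Finset.univ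
    (fun i : Fin m => y i.castSucc - z i.castSucc) (fun i : Fin m => z i.castSucc - c i.castSucc)
  have hexp : spatialSqDist c y = spatialSqDist z y + spatialSqDist c z +
      2 * ∑ i : Fin m, (y i.castSucc - z i.castSucc) * (z i.castSucc - c i.castSucc) := by
    simp only [spatialSqDist, Finset.mul_sum, ← Finset.sum_add_distrib]
    exact Finset.sum_congr rfl fun i _ => by ring
  have hle : (∑ i : Fin m, (y i.castSucc - z i.castSucc) * (z i.castSucc - c i.castSucc)) ^ 2 ≤
      (σ * ρ) ^ 2 := by
    refine hcs.trans ?_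
    rw [mul_pow]
    simp only [spatialSqDist, ← sq] at h₁ h₁'
    exact mul_le_mul h₁ h₁' (Finset.sum_nonneg fun _ _ => sq_nonneg _) (sq_nonneg _)
  have := abs_le_of_sq_le_sq' hle (by positivity) |>.2
  rw [hexp]
  nlinarith

lemma heatOp_nonpos_of_isMaxOn {w : EuclideanSpace ℝ (Fin (m + 1)) → ℝ} (hw : ContDiff ℝ ∞ w)
    {c z : EuclideanSpace ℝ (Fin (m + 1))} {ρ : ℝ} (hmax : IsMaxOn w (parabolicCylinder c ρ) z)
    (hz : z ∈ parabolicCylinder c ρ) (hspace : spatialSqDist c z < ρ ^ 2)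
    (htime : c (Fin.last m) - ρ ^ 2 < z (Fin.last m)) : heatOp w z ≤ 0 := by
  have hsp : ∀ i : Fin m, pd i.castSucc (pd i.castSucc w) z ≤ 0 := by
    intro i
    refine pd_pd_nonpos_of_slice_max _ hw ?_
    have hcont : Continuous fun s : ℝ =>
        spatialSqDist c (z + s • EuclideanSpace.single i.castSucc 1) :=
      (contDiff_spatialSqDist c).continuous.comp (by fun_prop)
    have hev := hcont.continuousAt.eventually_lt (continuousAt_const (x := (0 : ℝ)))
      (by simpa using hspace)
    filter_upwards [hev] with s hs
    refine hmax ⟨hs.le, ?_, ?_⟩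
    · simpa using hz.2.1
    · simpa using hz.2.2
  have ht : 0 ≤ pd (Fin.last m) w z := by
    refine pd_nonneg_of_backward_slice_max _ hw ?_
    have hev : ∀ᶠ s : ℝ in 𝓝[<] 0, c (Fin.last m) - ρ ^ 2 - z (Fin.last m) < s :=
      nhdsWithin_le_nhds (lt_mem_nhds (by linarith))
    filter_upwards [hev, self_mem_nhdsWithin] with s hs hs0
    have hs0 : s < 0 := hs0
    refine hmax ⟨?_, ?_, ?_⟩
    · simpa [spatialSqDist] using hz.1
    · simp
      linarith
    · simp
      linarith [hz.2.2]
  have := Finset.sum_nonpos fun i (_ : i ∈ Finset.univ) => hsp i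
  simp only [heatOp]
  linarith

/-- The polynomial cutoff `(ρ² - |x - x₀|²) (t - t₀ + ρ²)`, which vanishes on the parabolic
boundary of `parabolicCylinder c ρ` for `c = (x₀, t₀)`. -/
noncomputable def parabolicCutoff (c : EuclideanSpace ℝ (Fin (m + 1))) (ρ : ℝ)
    (z : EuclideanSpace ℝ (Fin (m + 1))) : ℝ :=
  (ρ ^ 2 + (-1) * spatialSqDist c z) * (z (Fin.last m) - c (Fin.last m) + ρ ^ 2)

lemma contDiff_cutoff_space (c : EuclideanSpace ℝ (Fin (m + 1))) (ρ : ℝ) :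
    ContDiff ℝ ∞ (fun z => ρ ^ 2 + (-1) * spatialSqDist c z) :=
  contDiff_const.add (contDiff_const.mul (contDiff_spatialSqDist c))

lemma contDiff_cutoff_time (c : EuclideanSpace ℝ (Fin (m + 1))) (ρ : ℝ) :
    ContDiff ℝ ∞ (fun z : EuclideanSpace ℝ (Fin (m + 1)) =>
      z (Fin.last m) - c (Fin.last m) + ρ ^ 2) :=
  (contDiff_sub_coord c _).add contDiff_const

lemma contDiff_parabolicCutoff (c : EuclideanSpace ℝ (Fin (m + 1))) (ρ : ℝ) :
    ContDiff ℝ ∞ (parabolicCutoff c ρ) :=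
  (contDiff_cutoff_space c ρ).mul (contDiff_cutoff_time c ρ)

lemma pd_cutoff_time (c : EuclideanSpace ℝ (Fin (m + 1))) (ρ : ℝ) (i : Fin (m + 1)) :
    pd i (fun z : EuclideanSpace ℝ (Fin (m + 1)) => z (Fin.last m) - c (Fin.last m) + ρ ^ 2) =
      fun _ => if Fin.last m = i then 1 else 0 := by
  rw [pd_add _ (contDiff_sub_coord c _) contDiff_const, pd_sub_coord, pd_const]
  simp

lemma heatOp_cutoff_time (c z : EuclideanSpace ℝ (Fin (m + 1))) (ρ : ℝ) :
    heatOp (fun z : EuclideanSpace ℝ (Fin (m + 1)) =>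
      z (Fin.last m) - c (Fin.last m) + ρ ^ 2) z = -1 := by
  simp [heatOp, pd_cutoff_time, pd_const]

lemma pd_parabolicCutoff (c z : EuclideanSpace ℝ (Fin (m + 1))) (ρ : ℝ) (i : Fin m) :
    pd i.castSucc (parabolicCutoff c ρ) z =
      -2 * (z (Fin.last m) - c (Fin.last m) + ρ ^ 2) * (z i.castSucc - c i.castSucc) := by
  unfold parabolicCutoff
  rw [pd_mul _ (contDiff_cutoff_space c ρ) (contDiff_cutoff_time c ρ), pd_cutoff_time,
    pd_add _ contDiff_const (contDiff_const.mul (contDiff_spatialSqDist c)),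
    pd_mul _ contDiff_const (contDiff_spatialSqDist c), pd_const, pd_const,
    pd_spatialSqDist_castSucc]
  simp [(Fin.castSucc_lt_last i).ne']
  ring

lemma heatOp_parabolicCutoff (c z : EuclideanSpace ℝ (Fin (m + 1))) (ρ : ℝ) :
    heatOp (parabolicCutoff c ρ) z = -(ρ ^ 2 - spatialSqDist c z) -
      2 * m * (z (Fin.last m) - c (Fin.last m) + ρ ^ 2) := by
  unfold parabolicCutoff
  rw [heatOp_mul (contDiff_cutoff_space c ρ) (contDiff_cutoff_time c ρ), heatOp_cutoff_time,
    heatOp_add contDiff_const (contDiff_const.mul (contDiff_spatialSqDist c)), heatOp_const,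
    heatOp_const_mul _ (contDiff_spatialSqDist c), heatOp_spatialSqDist]
  simp [pd_cutoff_time, (Fin.castSucc_lt_last _).ne']
  ring

lemma sum_pd_parabolicCutoff_sq (c z : EuclideanSpace ℝ (Fin (m + 1))) (ρ : ℝ) :
    ∑ i : Fin m, pd i.castSucc (parabolicCutoff c ρ) z * pd i.castSucc (parabolicCutoff c ρ) z =
      4 * (z (Fin.last m) - c (Fin.last m) + ρ ^ 2) ^ 2 * spatialSqDist c z := by
  simp only [pd_parabolicCutoff, spatialSqDist, Finset.mul_sum]
  exact Finset.sum_congr rfl fun i _ => by ring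

/-- The comparison function of Bernstein's method, `η² v² + A u² - ε (t - t₀ + ρ²)`. -/
noncomputable def bernsteinFun (c : EuclideanSpace ℝ (Fin (m + 1))) (ρ A ε : ℝ)
    (u v : EuclideanSpace ℝ (Fin (m + 1)) → ℝ) (z : EuclideanSpace ℝ (Fin (m + 1))) : ℝ :=
  parabolicCutoff c ρ z * parabolicCutoff c ρ z * (v z * v z) + A * (u z * u z) +
    (-ε) * (z (Fin.last m) - c (Fin.last m) + ρ ^ 2)

lemma contDiff_bernsteinFun (c : EuclideanSpace ℝ (Fin (m + 1))) (ρ A ε : ℝ)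
    {u v : EuclideanSpace ℝ (Fin (m + 1)) → ℝ} (hu : ContDiff ℝ ∞ u) (hv : ContDiff ℝ ∞ v) :
    ContDiff ℝ ∞ (bernsteinFun c ρ A ε u v) :=
  have hη := contDiff_parabolicCutoff c ρ
  (((hη.mul hη).mul (hv.mul hv)).add (contDiff_const.mul (hu.mul hu))).add
    (contDiff_const.mul (contDiff_cutoff_time c ρ))

lemma heatOp_bernsteinFun {c z : EuclideanSpace ℝ (Fin (m + 1))} {ρ A ε : ℝ}
    {u v : EuclideanSpace ℝ (Fin (m + 1)) → ℝ} (hu : ContDiff ℝ ∞ u) (hv : ContDiff ℝ ∞ v)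
    (hLu : heatOp u z = 0) (hLv : heatOp v z = 0) :
    heatOp (bernsteinFun c ρ A ε u v) z =
      ∑ i : Fin m, 2 * (parabolicCutoff c ρ z * pd i.castSucc v z +
        2 * v z * pd i.castSucc (parabolicCutoff c ρ) z) ^ 2 +
      v z ^ 2 * (2 * parabolicCutoff c ρ z * heatOp (parabolicCutoff c ρ) z -
        6 * ∑ i : Fin m,
          pd i.castSucc (parabolicCutoff c ρ) z * pd i.castSucc (parabolicCutoff c ρ) z) +
      2 * A * (∑ i : Fin m, pd i.castSucc u z * pd i.castSucc u z) + ε := by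
  have hη := contDiff_parabolicCutoff c ρ
  unfold bernsteinFun
  rw [heatOp_add (((hη.mul hη).mul (hv.mul hv)).add (contDiff_const.mul (hu.mul hu)))
      (contDiff_const.mul (contDiff_cutoff_time c ρ)),
    heatOp_add ((hη.mul hη).mul (hv.mul hv)) (contDiff_const.mul (hu.mul hu)),
    heatOp_const_mul _ (contDiff_cutoff_time c ρ), heatOp_cutoff_time,
    heatOp_const_mul _ (hu.mul hu), heatOp_mul hu hu, heatOp_mul (hη.mul hη) (hv.mul hv),
    heatOp_mul hη hη, heatOp_mul hv hv, hLu, hLv]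
  simp only [pd_mul _ hη hη, pd_mul _ hv hv]
  have hsum : ∑ i : Fin m, 2 * (parabolicCutoff c ρ z * pd i.castSucc v z +
        2 * v z * pd i.castSucc (parabolicCutoff c ρ) z) ^ 2 =
      2 * parabolicCutoff c ρ z ^ 2 * (∑ i : Fin m, pd i.castSucc v z * pd i.castSucc v z) +
      2 * ∑ i : Fin m, (parabolicCutoff c ρ z * pd i.castSucc (parabolicCutoff c ρ) z +
        parabolicCutoff c ρ z * pd i.castSucc (parabolicCutoff c ρ) z) *
        (v z * pd i.castSucc v z + v z * pd i.castSucc v z) +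
      8 * v z ^ 2 * ∑ i : Fin m,
        pd i.castSucc (parabolicCutoff c ρ) z * pd i.castSucc (parabolicCutoff c ρ) z := by
    simp only [Finset.mul_sum, ← Finset.sum_add_distrib]
    exact Finset.sum_congr rfl fun i _ => by ring
  rw [hsum]
  ring

lemma le_heatOp_bernsteinFun {U : Set (EuclideanSpace ℝ (Fin (m + 1)))} (hU : IsOpen U)
    {u : EuclideanSpace ℝ (Fin (m + 1)) → ℝ} (hu : ContDiff ℝ ∞ u) (hheat : IsHeatSolution U u)
    {c z : EuclideanSpace ℝ (Fin (m + 1))} {ρ : ℝ} (ε : ℝ)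
    (hz : z ∈ parabolicCylinder c ρ) (hzU : z ∈ U) (j : Fin m) :
    ε ≤ heatOp (bernsteinFun c ρ ((13 + 2 * m) * ρ ^ 6) ε u (pd j.castSucc u)) z := by
  rw [heatOp_bernsteinFun hu (hu.pd _) (hheat z hzU) (hheat.pd hU hu j.castSucc z hzU),
    sum_pd_parabolicCutoff_sq, heatOp_parabolicCutoff]
  obtain ⟨h₁, h₂, h₃⟩ := hz
  have hS := spatialSqDist_nonneg c z
  have hsq : 0 ≤ ∑ i : Fin m, 2 * (parabolicCutoff c ρ z * pd i.castSucc (pd j.castSucc u) z +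
      2 * pd j.castSucc u z * pd i.castSucc (parabolicCutoff c ρ) z) ^ 2 :=
    Finset.sum_nonneg fun _ _ => by positivity
  have hgrad : pd j.castSucc u z ^ 2 ≤ ∑ i : Fin m, pd i.castSucc u z * pd i.castSucc u z := by
    rw [sq]
    exact Finset.single_le_sum (f := fun i : Fin m => pd i.castSucc u z * pd i.castSucc u z)
      (fun i _ => mul_self_nonneg _) (Finset.mem_univ j)
  have hA : 0 ≤ (13 + 2 * m : ℝ) * ρ ^ 6 := by positivity
  have hη : parabolicCutoff c ρ z =
    (ρ ^ 2 - spatialSqDist c z) * (z (Fin.last m) - c (Fin.last m) + ρ ^ 2) := by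
    unfold parabolicCutoff
    ring
  rw [hη]
  set S := spatialSqDist c z
  obtain ⟨τ, hτ⟩ : ∃ τ, τ = z (Fin.last m) - c (Fin.last m) + ρ ^ 2 := ⟨_, rfl⟩
  obtain ⟨φ, hφ⟩ : ∃ φ, φ = ρ ^ 2 - S := ⟨_, rfl⟩
  have hτ0 : 0 ≤ τ := by linarith
  have hτ1 : τ ≤ ρ ^ 2 := by linarith
  have hφ0 : 0 ≤ φ := by linarith
  have hφ1 : φ ≤ ρ ^ 2 := by linarith
  have hφτ : φ * τ ≤ ρ ^ 2 * ρ ^ 2 := mul_le_mul hφ1 hτ1 hτ0 (by positivity)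
  have hL : φ + 2 * m * τ ≤ (1 + 2 * m) * ρ ^ 2 := by
    have : (m : ℝ) * τ ≤ m * ρ ^ 2 := mul_le_mul_of_nonneg_left hτ1 (Nat.cast_nonneg m)
    linarith
  have hηL : φ * τ * (φ + 2 * m * τ) ≤ ρ ^ 2 * ρ ^ 2 * ((1 + 2 * m) * ρ ^ 2) :=
    mul_le_mul hφτ hL (by positivity) (by positivity)
  have hG : τ ^ 2 * S ≤ (ρ ^ 2) ^ 2 * ρ ^ 2 :=
    mul_le_mul (pow_le_pow_left₀ hτ0 hτ1 2) h₁ hS (by positivity)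
  have hcoef : -(2 * ((13 + 2 * m) * ρ ^ 6)) ≤
      2 * (φ * τ) * (-φ - 2 * m * τ) - 6 * (4 * τ ^ 2 * S) := by
    linarith
  rw [hη] at hsq
  rw [← hτ, ← hφ] at hsq ⊢
  have h₄ := mul_le_mul_of_nonneg_left hcoef (sq_nonneg (pd j.castSucc u z))
  have h₅ := mul_le_mul_of_nonneg_left hgrad hA
  linarith

/-- Interior gradient estimate for the heat equation. -/
lemma spatial_pd_sq_le {U : Set (EuclideanSpace ℝ (Fin (m + 1)))} (hU : IsOpen U)
    {u : EuclideanSpace ℝ (Fin (m + 1)) → ℝ} (hu : ContDiff ℝ ∞ u) (hheat : IsHeatSolution U u)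
    {c : EuclideanSpace ℝ (Fin (m + 1))} {ρ M : ℝ} (hρ : 0 < ρ)
    (hQ : parabolicCylinder c ρ ⊆ U) (hM : ∀ z ∈ parabolicCylinder c ρ, |u z| ≤ M) (j : Fin m) :
    (ρ * pd j.castSucc u c) ^ 2 ≤ (13 + 2 * m) * M ^ 2 := by
  have hbound : ∀ ε > 0, ρ ^ 8 * pd j.castSucc u c ^ 2 ≤
      (13 + 2 * m) * ρ ^ 6 * M ^ 2 + ε * ρ ^ 2 := by
    intro ε hε
    have hw := contDiff_bernsteinFun c ρ ((13 + 2 * m) * ρ ^ 6) ε hu (hu.pd j.castSucc)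
    obtain ⟨z, hz, hmax⟩ := (isCompact_parabolicCylinder c ρ).exists_isMaxOn
      ⟨c, mem_parabolicCylinder_self c ρ⟩ hw.continuous.continuousOn
    have hη : parabolicCutoff c ρ z = 0 := by
      by_contra hne
      have hspace : spatialSqDist c z < ρ ^ 2 := by
        refine lt_of_le_of_ne hz.1 fun h => hne ?_
        simp [parabolicCutoff, h]
      have htime : c (Fin.last m) - ρ ^ 2 < z (Fin.last m) := by
        refine lt_of_le_of_ne hz.2.1 fun h => hne ?_
        simp [parabolicCutoff, ← h]
      linarith [heatOp_nonpos_of_isMaxOn hw hmax hz hspace htime,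
        le_heatOp_bernsteinFun hU hu hheat ε hz (hQ hz) j]
    have hcz := hmax (mem_parabolicCylinder_self c ρ)
    have hA : 0 ≤ (13 + 2 * m : ℝ) * ρ ^ 6 := by positivity
    have huz : u z ^ 2 ≤ M ^ 2 := sq_le_sq' (abs_le.1 (hM z hz)).1 (abs_le.1 (hM z hz)).2
    have hAz := mul_le_mul_of_nonneg_left huz hA
    have hAc := mul_nonneg hA (sq_nonneg (u c))
    have hτ : 0 ≤ ε * (z (Fin.last m) - c (Fin.last m) + ρ ^ 2) :=
      mul_nonneg hε.le (by linarith [hz.2.1])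
    simp only [Set.mem_ofPred_eq, bernsteinFun, hη] at hcz
    simp only [parabolicCutoff, spatialSqDist_self] at hcz
    linarith
  have hlim : ρ ^ 8 * pd j.castSucc u c ^ 2 ≤ (13 + 2 * m) * ρ ^ 6 * M ^ 2 := by
    refine le_of_forall_pos_le_add fun δ hδ => ?_
    have h := hbound (δ / ρ ^ 2) (by positivity)
    rwa [div_mul_cancel₀ _ (by positivity)] at h
  refine le_of_mul_le_mul_left ?_ (pow_pos hρ 6)
  linarith

end Bernstein

section Estimate

variable {m : ℕ}

lemma abs_spatial_pd_le {U : Set (EuclideanSpace ℝ (Fin (m + 1)))} (hU : IsOpen U)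
    {u : EuclideanSpace ℝ (Fin (m + 1)) → ℝ} (hu : ContDiff ℝ ∞ u) (hheat : IsHeatSolution U u)
    {c : EuclideanSpace ℝ (Fin (m + 1))} {ρ M : ℝ} (hρ : 0 < ρ)
    (hQ : parabolicCylinder c ρ ⊆ U) (hM : ∀ z ∈ parabolicCylinder c ρ, |u z| ≤ M) (j : Fin m) :
    |pd j.castSucc u c| ≤ (13 + 2 * m) / ρ * M := by
  have hM0 : 0 ≤ M := (abs_nonneg _).trans (hM c (mem_parabolicCylinder_self c ρ))
  have hC : (1 : ℝ) ≤ 13 + 2 * m := by linarith [(Nat.cast_nonneg m : (0 : ℝ) ≤ m)]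
  have h : (ρ * pd j.castSucc u c) ^ 2 ≤ ((13 + 2 * m) * M) ^ 2 := by
    refine (spatial_pd_sq_le hU hu hheat hρ hQ hM j).trans ?_
    rw [mul_pow]
    exact mul_le_mul_of_nonneg_right (by nlinarith) (sq_nonneg M)
  have h' := abs_le_of_sq_le_sq h (by positivity)
  rw [abs_mul, abs_of_pos hρ] at h'
  rw [div_mul_eq_mul_div, le_div_iff₀ hρ]
  linarith

lemma parabolicCylinder_mono (c : EuclideanSpace ℝ (Fin (m + 1))) {ρ σ : ℝ} (hρ : 0 ≤ ρ)
    (h : ρ ≤ σ) : parabolicCylinder c ρ ⊆ parabolicCylinder c σ := by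
  have hsq : ρ ^ 2 ≤ σ ^ 2 := pow_le_pow_left₀ hρ h 2
  rintro z ⟨h₁, h₂, h₃⟩
  exact ⟨h₁.trans hsq, by linarith, h₃⟩

/-- Interior estimate for all first order partial derivatives, including the time derivative. -/
lemma abs_pd_le {U : Set (EuclideanSpace ℝ (Fin (m + 1)))} (hU : IsOpen U)
    {u : EuclideanSpace ℝ (Fin (m + 1)) → ℝ} (hu : ContDiff ℝ ∞ u) (hheat : IsHeatSolution U u)
    {c : EuclideanSpace ℝ (Fin (m + 1))} {ρ M : ℝ} (hρ : 0 < ρ) (hρ1 : ρ ≤ 1)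
    (hQ : parabolicCylinder c (ρ + ρ) ⊆ U)
    (hM : ∀ z ∈ parabolicCylinder c (ρ + ρ), |u z| ≤ M) (i : Fin (m + 1)) :
    |pd i u c| ≤ ((m + 1) * (13 + 2 * m) ^ 2) / ρ ^ 2 * M := by
  have hM0 : 0 ≤ M := (abs_nonneg _).trans (hM c (mem_parabolicCylinder_self c _))
  obtain ⟨C, hC⟩ : ∃ C : ℝ, C = 13 + 2 * m := ⟨_, rfl⟩
  have hm : (0 : ℝ) ≤ m := Nat.cast_nonneg m
  have hC1 : 1 ≤ C := by linarith
  have hfirst : ∀ (j : Fin m), ∀ z ∈ parabolicCylinder c ρ,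
      |pd j.castSucc u z| ≤ C / ρ * M := by
    intro j z hz
    have hsub := parabolicCylinder_subset hρ.le hρ.le hz
    rw [hC]
    exact abs_spatial_pd_le hU hu hheat hρ (hsub.trans hQ) (fun y hy => hM y (hsub hy)) j
  have hsub := parabolicCylinder_mono c hρ.le (by linarith : ρ ≤ ρ + ρ)
  have hCρ : 1 ≤ C / ρ := by
    rw [le_div_iff₀ hρ]
    linarith
  have hK : ((m + 1) * C ^ 2) / ρ ^ 2 * M = (m + 1) * (C / ρ * (C / ρ * M)) := by
    field_simp
  rw [← hC, hK]
  have hX : 0 ≤ C / ρ * M := by positivity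
  have hX2 : C / ρ * M ≤ C / ρ * (C / ρ * M) := le_mul_of_one_le_left hX hCρ
  refine Fin.lastCases ?_ (fun j => ?_) i
  · have hlast : pd (Fin.last m) u c = ∑ j : Fin m, pd j.castSucc (pd j.castSucc u) c := by
      linarith [hheat c (hQ (mem_parabolicCylinder_self c _))]
    have hsecond : ∀ j : Fin m, |pd j.castSucc (pd j.castSucc u) c| ≤ C / ρ * (C / ρ * M) := by
      intro j
      rw [hC]
      exact abs_spatial_pd_le hU (hu.pd _) (hheat.pd hU hu _) hρ (hsub.trans hQ)
        (fun z hz => hC ▸ hfirst j z hz) j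
    rw [hlast]
    calc |∑ j : Fin m, pd j.castSucc (pd j.castSucc u) c|
        ≤ ∑ j : Fin m, |pd j.castSucc (pd j.castSucc u) c| := Finset.abs_sum_le_sum_abs _ _
      _ ≤ ∑ _j : Fin m, C / ρ * (C / ρ * M) := Finset.sum_le_sum fun j _ => hsecond j
      _ = m * (C / ρ * (C / ρ * M)) := by simp
      _ ≤ (m + 1) * (C / ρ * (C / ρ * M)) := by linarith
  · have h1 := hfirst j c (mem_parabolicCylinder_self c _)
    have h2 : 0 ≤ m * (C / ρ * (C / ρ * M)) := by positivity
    linarith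

lemma abs_pd_pd_le {U : Set (EuclideanSpace ℝ (Fin (m + 1)))} (hU : IsOpen U)
    {u : EuclideanSpace ℝ (Fin (m + 1)) → ℝ} (hu : ContDiff ℝ ∞ u) (hheat : IsHeatSolution U u)
    {c : EuclideanSpace ℝ (Fin (m + 1))} {ρ M : ℝ} (hρ : 0 < ρ) (hρ1 : ρ ≤ 1)
    (hQ : parabolicCylinder c ((ρ + ρ) + (ρ + ρ)) ⊆ U)
    (hM : ∀ z ∈ parabolicCylinder c ((ρ + ρ) + (ρ + ρ)), |u z| ≤ M) (i j : Fin (m + 1)) :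
    |pd i (pd j u) c| ≤ ((m + 1) * (13 + 2 * m) ^ 2) / ρ ^ 2 *
      (((m + 1) * (13 + 2 * m) ^ 2) / ρ ^ 2 * M) := by
  have h2ρ : 0 ≤ ρ + ρ := by linarith
  refine abs_pd_le hU (hu.pd j) (hheat.pd hU hu j) hρ hρ1
    ((parabolicCylinder_mono c h2ρ (by linarith)).trans hQ) (fun z hz => ?_) i
  have hsub := parabolicCylinder_subset h2ρ h2ρ hz
  exact abs_pd_le hU hu hheat hρ hρ1 (hsub.trans hQ) (fun y hy => hM y (hsub hy)) j

lemma parabolicCylinder_subset_ball {a z : EuclideanSpace ℝ (Fin (m + 1))} {r : ℝ} (hr : 0 < r)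
    (hr1 : r < 1) (hz : z ∈ ball a (r ^ 2 / 4)) :
    parabolicCylinder z (r / 2) ⊆ ball a (9 / 10 * r) := by
  rintro y ⟨h₁, h₂, h₃⟩
  rw [mem_ball] at hz ⊢
  have hr2 : r ^ 2 ≤ r := by nlinarith
  have hyz : dist y z ≤ 3 / 5 * r := by
    refine abs_le_of_sq_le_sq' ?_ (by positivity) |>.2
    rw [dist_sq_eq_spatialSqDist_add]
    have ht : (y (Fin.last m) - z (Fin.last m)) ^ 2 ≤ (r / 4) ^ 2 :=
      sq_le_sq' (by nlinarith) (by nlinarith)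
    nlinarith
  linarith [dist_triangle y z a]

end Estimate

section MultiIndex

variable {n : ℕ}

lemma foldr_pdIter_of_sum_eq_zero (k : Fin n → ℕ) (f : EuclideanSpace ℝ (Fin n) → ℝ)
    (l : List (Fin n)) (h : (l.map k).sum = 0) :
    l.foldr (fun i g => pdIter i (k i) g) f = f := by
  induction l with
  | nil => rfl
  | cons i l ih =>
    simp only [List.map_cons, List.sum_cons, Nat.add_eq_zero_iff] at h
    simp [ih h.2, h.1, pdIter]

lemma foldr_pdIter_of_sum_eq_one (k : Fin n → ℕ) (f : EuclideanSpace ℝ (Fin n) → ℝ)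
    (l : List (Fin n)) (h : (l.map k).sum = 1) :
    ∃ i, l.foldr (fun i g => pdIter i (k i) g) f = pd i f := by
  induction l with
  | nil => simp at h
  | cons i l ih =>
    simp only [List.map_cons, List.sum_cons] at h
    obtain ⟨hi, hl⟩ | ⟨hi, hl⟩ : (k i = 0 ∧ (l.map k).sum = 1) ∨
        (k i = 1 ∧ (l.map k).sum = 0) := by omega
    · obtain ⟨j, hj⟩ := ih hl
      exact ⟨j, by simp [hj, hi, pdIter]⟩
    · exact ⟨i, by simp [foldr_pdIter_of_sum_eq_zero k f l hl, hi, pdIter]⟩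

lemma foldr_pdIter_of_sum_eq_two (k : Fin n → ℕ) (f : EuclideanSpace ℝ (Fin n) → ℝ)
    (l : List (Fin n)) (h : (l.map k).sum = 2) :
    ∃ i j, l.foldr (fun i g => pdIter i (k i) g) f = pd i (pd j f) := by
  induction l with
  | nil => simp at h
  | cons i l ih =>
    simp only [List.map_cons, List.sum_cons] at h
    obtain ⟨hi, hl⟩ | ⟨hi, hl⟩ | ⟨hi, hl⟩ : (k i = 0 ∧ (l.map k).sum = 2) ∨
        (k i = 1 ∧ (l.map k).sum = 1) ∨ (k i = 2 ∧ (l.map k).sum = 0) := by omega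
    · obtain ⟨j, j', hj⟩ := ih hl
      exact ⟨j, j', by simp [hj, hi, pdIter]⟩
    · obtain ⟨j, hj⟩ := foldr_pdIter_of_sum_eq_one k f l hl
      exact ⟨i, j, by simp [hj, hi, pdIter]⟩
    · exact ⟨i, i, by simp [foldr_pdIter_of_sum_eq_zero k f l hl, hi, pdIter]⟩

lemma mderiv_of_sum_eq_one {k : Fin n → ℕ} (hk : ∑ i, k i = 1)
    (f : EuclideanSpace ℝ (Fin n) → ℝ) : ∃ i, mderiv k f = pd i f :=
  foldr_pdIter_of_sum_eq_one k f _ (by rwa [Fin.sum_univ_def] at hk)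

lemma mderiv_of_sum_eq_two {k : Fin n → ℕ} (hk : ∑ i, k i = 2)
    (f : EuclideanSpace ℝ (Fin n) → ℝ) : ∃ i j, mderiv k f = pd i (pd j f) :=
  foldr_pdIter_of_sum_eq_two k f _ (by rwa [Fin.sum_univ_def] at hk)

end MultiIndex

/-- A smooth function on a neighbourhood of a closed ball agrees, on any smaller concentric ball,
with a globally smooth function. -/
lemma exists_contDiff_eqOn_ball {n : ℕ} {Ω : Set (EuclideanSpace ℝ (Fin n))}
    {u : EuclideanSpace ℝ (Fin n) → ℝ} (hΩ : IsOpen Ω) (hu : ContDiffOn ℝ ∞ u Ω)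
    {a : EuclideanSpace ℝ (Fin n)} {s r : ℝ} (hs : 0 < s) (hsr : s < r)
    (ha : closedBall a r ⊆ Ω) :
    ∃ v : EuclideanSpace ℝ (Fin n) → ℝ, ContDiff ℝ ∞ v ∧ Set.EqOn v u (ball a s) := by
  let b : ContDiffBump a := ⟨s, r, hs, hsr⟩
  refine ⟨fun z => b z * u z, ?_, fun z hz => ?_⟩
  · rw [contDiff_iff_contDiffAt]
    intro z
    by_cases hz : z ∈ closedBall a r
    · exact b.contDiffAt.mul (hu.contDiffAt (hΩ.mem_nhds (ha hz)))
    · refine (contDiffAt_const (c := (0 : ℝ))).congr_of_eventuallyEq ?_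
      filter_upwards [isClosed_closedBall.isOpen_compl.mem_nhds hz] with y hy
      have hy' : r ≤ dist y a := by
        rw [Set.mem_compl_iff, mem_closedBall, not_le] at hy
        exact hy.le
      simp [b.zero_of_le_dist hy']
  · simp [b.one_of_mem_closedBall (ball_subset_closedBall hz)]

/-- Rescaled interior derivative estimate: there is a constant `a_m ≥ 1`, depending only on
the dimension, such that for any solution `u` of the heat equation on an open set `Ω`, any
`0 < r < 1` and any point `a` with `closedBall a r ⊆ Ω`, one has
`sup_{B_{r²/4}(a)} |∂^k u| ≤ (a_m / r^{2|k|}) · sup_{B_r(a)} |u|`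
for all multiindices `k` with `|k| ∈ {1, 2}`. -/
theorem heat_rescaled_derivative_estimate (m : ℕ) :
    ∃ a_m : ℝ, 1 ≤ a_m ∧
      ∀ (Ω : Set (EuclideanSpace ℝ (Fin (m + 1)))) (u : EuclideanSpace ℝ (Fin (m + 1)) → ℝ),
        IsOpen Ω → ContDiffOn ℝ (⊤ : ℕ∞) u Ω → IsHeatSolution Ω u →
        ∀ r : ℝ, 0 < r → r < 1 →
        ∀ a : EuclideanSpace ℝ (Fin (m + 1)), closedBall a r ⊆ Ω →
        ∀ k : Fin (m + 1) → ℕ, (∑ i, k i = 1 ∨ ∑ i, k i = 2) →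
        ∀ M : ℝ, (∀ z ∈ ball a r, |u z| ≤ M) →
        ∀ z ∈ ball a (r ^ 2 / 4),
          |mderiv k u z| ≤ (a_m / r ^ (2 * ∑ i, k i)) * M := by
  obtain ⟨K, hK⟩ : ∃ K : ℝ, K = (m + 1) * (13 + 2 * m) ^ 2 := ⟨_, rfl⟩
  have hm : (0 : ℝ) ≤ m := Nat.cast_nonneg m
  have hK1 : 1 ≤ K := by
    rw [hK]
    nlinarith [mul_nonneg hm hm]
  refine ⟨(64 * K) ^ 2, one_le_pow₀ (by linarith), ?_⟩
  intro Ω u hΩ hu hheat r hr hr1 a ha k hk M hM z hz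
  obtain ⟨v, hv, hvu⟩ := exists_contDiff_eqOn_ball hΩ hu (by positivity : 0 < 9 / 10 * r)
    (by linarith) ha
  have hsub : ball a (9 / 10 * r) ⊆ ball a r := ball_subset_ball (by linarith)
  have hgerm : ∀ y ∈ ball a (9 / 10 * r), v =ᶠ[𝓝 y] u := fun y hy =>
    hvu.eventuallyEq_of_mem (isOpen_ball.mem_nhds hy)
  have hvheat : IsHeatSolution (ball a (9 / 10 * r)) v := by
    intro y hy
    have h := hheat y (ha (ball_subset_closedBall (hsub hy)))
    have hfirst : ∀ i, pd i v =ᶠ[𝓝 y] pd i u := fun i => pd_congr i (hgerm y hy)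
    simpa only [(hfirst _).eq_of_nhds, (pd_congr _ (hfirst _)).eq_of_nhds] using h
  have hQ := parabolicCylinder_subset_ball hr hr1 hz
  have hvM : ∀ y ∈ parabolicCylinder z (r / 2), |v y| ≤ M := by
    intro y hy
    rw [hvu (hQ hy)]
    exact hM y (hsub (hQ hy))
  have hzB : z ∈ ball a (9 / 10 * r) := hQ (mem_parabolicCylinder_self z _)
  have hM0 : 0 ≤ M := (abs_nonneg _).trans (hM z (hsub hzB))
  have hρ : 0 < r / 8 := by positivity
  have hρ1 : r / 8 ≤ 1 := by linarith
  have hsum : (r / 8 + r / 8) + (r / 8 + r / 8) = r / 2 := by ring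
  have hKρ : K / (r / 8) ^ 2 = 64 * K / r ^ 2 := by
    field_simp
    norm_num
  rcases hk with hk | hk
  · obtain ⟨i, hi⟩ := mderiv_of_sum_eq_one hk u
    rw [hi, hk, ← (pd_congr i (hgerm z hzB)).eq_of_nhds]
    have hmono := parabolicCylinder_mono z (by positivity : 0 ≤ r / 8 + r / 8)
      (by linarith : r / 8 + r / 8 ≤ r / 2)
    have h := abs_pd_le isOpen_ball hv hvheat hρ hρ1 (hmono.trans hQ)
      (fun y hy => hvM y (hmono hy)) i
    rw [← hK, hKρ] at h
    refine h.trans (mul_le_mul_of_nonneg_right ?_ hM0)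
    rw [mul_one]
    exact div_le_div_of_nonneg_right (by nlinarith) (by positivity)
  · obtain ⟨i, j, hij⟩ := mderiv_of_sum_eq_two hk u
    rw [hij, hk, ← (pd_congr i (pd_congr j (hgerm z hzB))).eq_of_nhds]
    rw [← hsum] at hQ hvM
    have h := abs_pd_pd_le isOpen_ball hv hvheat hρ hρ1 hQ hvM i j
    rw [← hK, hKρ] at h
    refine h.trans_eq ?_
    rw [pow_mul, ← div_pow]
    ring
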